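/- Let X be a connected uniform space whose uniformity is induced by a metric. Then X is weakly chained if and only if X is locally uniformly joinable. -/

import Mathlib

/-! Basic definitions: chains, `E`-homotopy, generalized paths, and the
joinability properties of uniform spaces, following Brodskiy–Dydak–LaBuz–Mitra
and Plaut. -/

/-- A subset `A` of `X` is `E`-bounded if `A × A ⊆ E`. -/
def IsEBounded {X : Type*} (E : Set (X × X)) (A : Set X) : Prop :=
  ∀ a ∈ A, ∀ b ∈ A, (a, b) ∈ E

/-- A list of points is an `E`-chain if every pair of consecutive points
belongs to `E`. -/
def IsEChain {X : Type*} (E : Set (X × X)) (c : List X) : Prop :=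
  c.Chain' fun a b => (a, b) ∈ E

/-- `c` is an `E`-chain from `x` to `y`. -/
def IsEChainFromTo {X : Type*} (E : Set (X × X)) (c : List X) (x y : X) : Prop :=
  IsEChain E c ∧ c.head? = some x ∧ c.getLast? = some y

/-- A basic move inserts a single point `z` between two consecutive points
`a`, `b` of a chain, in such a way that `{a, z, b}` is `E`-bounded. -/
def BasicMove {X : Type*} (E : Set (X × X)) (c d : List X) : Prop :=
  ∃ (p q : List X) (a z b : X),
    IsEBounded E {a, z, b} ∧ c = p ++ a :: b :: q ∧ d = p ++ a :: z :: b :: q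

/-- Two `E`-chains are `E`-homotopic if one can be obtained from the other by a
finite sequence of basic moves (insertions or deletions); endpoints are kept
fixed automatically. -/
def EHomotopic {X : Type*} (E : Set (X × X)) : List X → List X → Prop :=
  Relation.EqvGen (BasicMove E)

/-- A generalized path from `x` to `y` in a uniform space `X`: a compatible
family of (`E`-homotopy classes of) `E`-chains from `x` to `y`, indexed by the
entourages `E` of `X`.  It is recorded by a choice of representative chain for
each entourage, such that for `F ⊆ E` the representative at `F` is
`E`-homotopic to the representative at `E` (this determines, and is determined
by, the family of homotopy classes). -/
structure GenPath {X : Type*} [UniformSpace X] (x y : X) where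
  /-- a representative `E`-chain for each entourage `E` -/
  chain : ∀ E : Set (X × X), E ∈ uniformity X → List X
  isChain : ∀ (E : Set (X × X)) (hE : E ∈ uniformity X),
    IsEChainFromTo E (chain E hE) x y
  compat : ∀ (F E : Set (X × X)) (hF : F ∈ uniformity X) (hE : E ∈ uniformity X),
    F ⊆ E → EHomotopic E (chain F hF) (chain E hE)

/-- A generalized path from `x` to `y` is `E`-short if its `E`-level homotopy
class is the class of the two-point chain `x, y`. -/
def GenPath.EShort {X : Type*} [UniformSpace X] {x y : X} (α : GenPath x y)
    (E : Set (X × X)) : Prop :=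
  ∀ hE : E ∈ uniformity X, EHomotopic E (α.chain E hE) [x, y]

/-- `X` is chain connected if for every entourage `E`, every pair of points of
`X` can be joined by an `E`-chain. -/
def ChainConnected (X : Type*) [UniformSpace X] : Prop :=
  ∀ E ∈ uniformity X, ∀ x y : X, ∃ c : List X, IsEChainFromTo E c x y

/-- `X` is uniformly joinable if every pair of points can be joined by a
generalized path. -/
def UniformlyJoinable (X : Type*) [UniformSpace X] : Prop :=
  ∀ x y : X, Nonempty (GenPath x y)

/-- `X` is locally uniformly joinable if for every entourage `E` there is an
entourage `F` such that any pair `(x, y) ∈ F` can be joined by an `E`-short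
generalized path. -/
def LocallyUniformlyJoinable (X : Type*) [UniformSpace X] : Prop :=
  ∀ E ∈ uniformity X, ∃ F ∈ uniformity X, ∀ x y : X, (x, y) ∈ F →
    ∃ α : GenPath x y, α.EShort E

/-- `X` is weakly chained if it is chain connected and for every entourage `E`
there is an entourage `F ⊆ E` such that every pair `(x, y) ∈ F` can be joined
by arbitrarily fine chains that are `E`-short (i.e. for every entourage `G`
there is a `G`-chain from `x` to `y` that is `E`-homotopic to the two-point
chain `x, y`). -/
def WeaklyChained (X : Type*) [UniformSpace X] : Prop :=
  ChainConnected X ∧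
    ∀ E ∈ uniformity X, ∃ F ∈ uniformity X, F ⊆ E ∧
      ∀ x y : X, (x, y) ∈ F → ∀ G ∈ uniformity X,
        ∃ c : List X, IsEChainFromTo G c x y ∧ EHomotopic E c [x, y]

open scoped Uniformity Topology

section Chains

variable {X : Type*} {E F : Set (X × X)}

theorem BasicMove.mono (h : F ⊆ E) {c d : List X} (hcd : BasicMove F c d) :
    BasicMove E c d := by
  obtain ⟨p, q, a, z, b, hb, rfl, rfl⟩ := hcd
  exact ⟨p, q, a, z, b, fun u hu v hv => h (hb u hu v hv), rfl, rfl⟩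

theorem BasicMove.append_context {c d : List X} (h : BasicMove E c d) (p q : List X) :
    BasicMove E (p ++ c ++ q) (p ++ d ++ q) := by
  obtain ⟨p', q', a, z, b, hb, rfl, rfl⟩ := h
  exact ⟨p ++ p', q' ++ q, a, z, b, hb, by simp, by simp⟩

theorem EHomotopic.mono (h : F ⊆ E) {c d : List X} (hcd : EHomotopic F c d) :
    EHomotopic E c d :=
  Relation.EqvGen.mono (fun _ _ => BasicMove.mono h) _ _ hcd

theorem EHomotopic.symm {c d : List X} (h : EHomotopic E c d) : EHomotopic E d c :=
  Relation.EqvGen.symm _ _ h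

theorem EHomotopic.trans {c d e : List X} (h : EHomotopic E c d) (h' : EHomotopic E d e) :
    EHomotopic E c e :=
  Relation.EqvGen.trans _ _ _ h h'

theorem EHomotopic.append_context {c d : List X} (h : EHomotopic E c d) (p q : List X) :
    EHomotopic E (p ++ c ++ q) (p ++ d ++ q) := by
  induction h with
  | rel c d h => exact .rel _ _ (h.append_context p q)
  | refl c => exact .refl _
  | symm c d _ ih => exact ih.symm
  | trans c d e _ _ ih ih' => exact ih.trans ih'

theorem IsEChainFromTo.mono (h : F ⊆ E) {c : List X} {x y : X} (hc : IsEChainFromTo F c x y) :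
    IsEChainFromTo E c x y :=
  ⟨List.IsChain.imp (fun _ _ hab => h hab) hc.1, hc.2⟩

theorem IsEChainFromTo.pair {x y : X} (h : (x, y) ∈ E) : IsEChainFromTo E [x, y] x y :=
  ⟨List.isChain_pair.2 h, rfl, rfl⟩

theorem IsEChainFromTo.append_overlap {p t : List X} {a b y : X}
    (h : IsEChainFromTo E (p ++ [b]) a b) (h' : IsEChainFromTo E (b :: t) b y) :
    IsEChainFromTo E (p ++ b :: t) a y := by
  refine ⟨List.isChain_split.2 ⟨h.1, h'.1⟩, ?_, ?_⟩
  · have := h.2.1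
    cases p <;> simpa using this
  · have := h'.2.2
    simpa [List.getLast?_append] using this

theorem IsEChainFromTo.exists_of_reflTransGen {x y : X}
    (h : Relation.ReflTransGen (fun a b => (a, b) ∈ E) x y) :
    ∃ c, IsEChainFromTo E c x y := by
  obtain ⟨l, hl, hlast⟩ := List.exists_isChain_cons_of_relationReflTransGen h
  exact ⟨x :: l, hl, rfl, by rw [List.getLast?_eq_some_getLast (List.cons_ne_nil _ _), hlast]⟩

/-- If every pair in `F` is joined by an `E`-short `G`-chain, then every `F`-chain can be refined
to a `G`-chain in the same `E`-homotopy class. -/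
theorem IsEChainFromTo.exists_refinement {G : Set (X × X)}
    (hF : ∀ a b, (a, b) ∈ F → ∃ c, IsEChainFromTo G c a b ∧ EHomotopic E c [a, b])
    {l : List X} {x y : X} (hl : IsEChainFromTo F l x y) :
    ∃ l', IsEChainFromTo G l' x y ∧ EHomotopic E l' l := by
  induction l generalizing x with
  | nil => simp [IsEChainFromTo] at hl
  | cons a q ih =>
    obtain ⟨hchain, hhead, hlast⟩ := hl
    obtain rfl : a = x := by simpa using hhead
    cases q with
    | nil =>
      obtain rfl : a = y := by simpa using hlast
      exact ⟨[a], ⟨List.isChain_singleton a, rfl, rfl⟩, .refl _⟩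
    | cons b q =>
      obtain ⟨hab, hbq⟩ := List.isChain_cons_cons.1 hchain
      obtain ⟨t, ht, htq⟩ := ih (x := b) ⟨hbq, rfl, by simpa using hlast⟩
      obtain ⟨c, hc, hcab⟩ := hF a b hab
      obtain ⟨p, rfl⟩ := List.getLast?_eq_some_iff.1 hc.2.2
      obtain ⟨t, rfl⟩ := List.head?_eq_some_iff.1 ht.2.1
      refine ⟨p ++ b :: t, hc.append_overlap ht, ?_⟩
      have h₁ := htq.append_context p []
      have h₂ := hcab.append_context [] q
      simp only [List.append_nil, List.nil_append, List.append_assoc, List.cons_append] at h₁ h₂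
      exact h₁.trans h₂

end Chains

section UniformSpace

variable {X : Type*} [UniformSpace X]

theorem chainConnected_of_preconnectedSpace [PreconnectedSpace X] : ChainConnected X := by
  intro E hE x y
  refine IsEChainFromTo.exists_of_reflTransGen
    (PreconnectedSpace.induction₂' _ (fun z => ?_) ⟨fun _ _ _ => .trans⟩ x y)
  filter_upwards [UniformSpace.ball_mem_nhds z hE,
    UniformSpace.ball_mem_nhds z (symm_le_uniformity hE)] with w hw hw'
  exact ⟨.single hw, .single hw'⟩

theorem LocallyUniformlyJoinable.weaklyChained (hX : ChainConnected X)
    (h : LocallyUniformlyJoinable X) : WeaklyChained X := by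
  refine ⟨hX, fun E hE => ?_⟩
  obtain ⟨F, hF, hFE⟩ := h E hE
  refine ⟨F ∩ E, Filter.inter_mem hF hE, Set.inter_subset_right, fun x y hxy G hG => ?_⟩
  obtain ⟨α, hα⟩ := hFE x y hxy.1
  have hGE := Filter.inter_mem hG hE
  exact ⟨α.chain _ hGE, (α.isChain _ hGE).mono Set.inter_subset_left,
    (α.compat _ E hGE hE Set.inter_subset_right).trans (hα hE)⟩

/-- A sequence of chains along an antitone basis of entourages, with consecutive chains homotopic
at the coarser level, determines a generalized path. -/
theorem GenPath.exists_of_seq {D : ℕ → Set (X × X)} (hD : (𝓤 X).HasAntitoneBasis D)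
    {x y : X} {c : ℕ → List X} (hc : ∀ n, IsEChainFromTo (D n) (c n) x y)
    (hcc : ∀ n, EHomotopic (D n) (c (n + 1)) (c n)) :
    ∃ α : GenPath x y, ∀ E hE, D 0 ⊆ E → EHomotopic E (α.chain E hE) (c 0) := by
  have hle : ∀ m n, m ≤ n → EHomotopic (D m) (c n) (c m) := by
    intro m n hmn
    induction n, hmn using Nat.le_induction with
    | base => exact .refl _
    | succ n hmn ih => exact ((hcc n).mono (hD.antitone hmn)).trans ih
  choose N hN using fun (E : Set (X × X)) (hE : E ∈ 𝓤 X) => hD.mem_iff.1 hE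
  refine ⟨⟨fun E hE => c (N E hE), fun E hE => (hc _).mono (hN E hE), ?_⟩, ?_⟩
  · intro F E hF hE hFE
    rcases le_total (N F hF) (N E hE) with h | h
    · exact ((hle _ _ h).mono ((hN F hF).trans hFE)).symm
    · exact (hle _ _ h).mono (hN E hE)
  · exact fun E hE h => (hle 0 _ (Nat.zero_le _)).mono h

theorem WeaklyChained.locallyUniformlyJoinable [(𝓤 X).IsCountablyGenerated]
    (h : WeaklyChained X) : LocallyUniformlyJoinable X := by
  intro E hE
  obtain ⟨B, hB⟩ := (𝓤 X).exists_antitone_basis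
  have hD : (𝓤 X).HasAntitoneBasis fun n => E ∩ B n :=
    ⟨⟨fun s => ⟨fun hs => (hB.mem_iff.1 hs).imp fun n hn =>
        ⟨trivial, Set.inter_subset_right.trans hn⟩,
      fun ⟨n, _, hn⟩ => Filter.mem_of_superset (Filter.inter_mem hE (hB.mem n)) hn⟩⟩,
      fun _ _ hmn => Set.inter_subset_inter_right E (hB.antitone hmn)⟩
  choose F hF hFD hshort using fun n => h.2 (E ∩ B n) (hD.mem n)
  refine ⟨F 0, hF 0, fun x y hxy => ?_⟩
  have hstep : ∀ n l, ∃ l', IsEChainFromTo (F n) l x y →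
      IsEChainFromTo (F (n + 1)) l' x y ∧ EHomotopic (E ∩ B n) l' l := fun n l => by
    by_cases hl : IsEChainFromTo (F n) l x y
    · obtain ⟨l', hl'⟩ := hl.exists_refinement fun a b hab =>
        hshort n a b hab (F (n + 1)) (hF (n + 1))
      exact ⟨l', fun _ => hl'⟩
    · exact ⟨l, fun hl' => absurd hl' hl⟩
  choose next hnext using hstep
  let c : ℕ → List X := Nat.rec [x, y] next
  have hc : ∀ n, IsEChainFromTo (F n) (c n) x y := by
    intro n
    induction n with
    | zero => exact .pair hxy
    | succ n ih => exact (hnext n (c n) ih).1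
  obtain ⟨α, hα⟩ := GenPath.exists_of_seq hD (fun n => (hc n).mono (hFD n))
    fun n => (hnext n (c n) (hc n)).2
  exact ⟨α, fun hE => hα E hE Set.inter_subset_left⟩

end UniformSpace

/-- A connected metrizable uniform space is weakly chained if and only if it is
locally uniformly joinable. -/
theorem weaklyChained_iff_locallyUniformlyJoinable {X : Type*} [MetricSpace X]
    [ConnectedSpace X] : WeaklyChained X ↔ LocallyUniformlyJoinable X :=
  ⟨WeaklyChained.locallyUniformlyJoinable,
    LocallyUniformlyJoinable.weaklyChained chainConnected_of_preconnectedSpace⟩
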